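/- arXiv:2006.01405 — 2 statements merged into one kernel-verified Lean document; each statement's English description precedes it below -/
import Mathlib

section
/- Suppose λσ = 1. Then there exist constants δ > 0 and C > 0 such that for every integer k ≥ 1 and every (x,y) with k|xy| ≤ δ and T₀^j(x,y) ∈ N for all j = 0,…,k−1, the components (X_k, Y_k) = T₀^k(x,y) satisfy |X_k − λ^k x (1 + k a₁ x y)| ≤ C |λ|^k |x| k² x² y² and |Y_k − λ^{−k} y (1 + k b₁ x y)| ≤ C |λ|^{−k} |y| k² x² y². -/
noncomputable section

open Filter Topology in
/-- A function differentiable at `0` is bounded and satisfies a Lipschitz bound at `0` nearby,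
with an arbitrarily large common constant. -/
theorem exists_local_bounds {F : ℝ → ℝ} (hF : DifferentiableAt ℝ F 0) :
    ∃ M₀ : ℝ, ∀ M ≥ M₀, ∀ᶠ s in 𝓝 (0 : ℝ), |F s| ≤ M ∧ |F s - F 0| ≤ M * |s| := by
  obtain ⟨c, hc⟩ := hF.hasDerivAt.isBigO_sub.bound
  refine ⟨max c (|F 0| + 1), fun M hM => ?_⟩
  have hcont : ∀ᶠ s in 𝓝 (0 : ℝ), |F s| < |F 0| + 1 :=
    hF.continuousAt.abs.eventually_lt continuousAt_const (by simp)
  filter_upwards [hc, hcont] with s hs hs'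
  refine ⟨hs'.le.trans ((le_max_right _ _).trans hM), ?_⟩
  simp only [Real.norm_eq_abs, sub_zero] at hs
  exact hs.trans (mul_le_mul_of_nonneg_right ((le_max_left _ _).trans hM) (abs_nonneg s))

/-- A sequence with increments quadratic in its terms stays within `O(j s²)` of its initial value
`s` as long as `j |s|` is small. -/
theorem abs_sub_le_of_quadratic_recursion {s : ℕ → ℝ} {A B : ℝ → ℝ} {M r : ℝ} {k : ℕ}
    (hM : 1 ≤ M) (hA : ∀ t, |t| ≤ r → |A t| ≤ M) (hB : ∀ t, |t| ≤ r → |B t| ≤ M)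
    (hs : ∀ j, s (j + 1) = s j * (1 + s j * A (s j)) * (1 + s j * B (s j)))
    (hr : 2 * (k * |s 0|) ≤ r) (hk : 18 * M * (k * |s 0|) ≤ 1) {j : ℕ} (hj : j < k) :
    |s j - s 0| ≤ 12 * M * j * s 0 ^ 2 ∧ |s j| ≤ 2 * |s 0| := by
  have h0 := abs_nonneg (s 0)
  induction j with
  | zero => exact ⟨by simp, by linarith⟩
  | succ j ih =>
    obtain ⟨hd, hle⟩ := ih (by omega)
    have hk1 : (j : ℝ) + 1 ≤ k := by exact_mod_cast hj.le
    have hj0 : (0 : ℝ) ≤ j := Nat.cast_nonneg j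
    have hsk : |s 0| ≤ k * |s 0| := by nlinarith
    have hsr : |s j| ≤ r := by linarith
    have hMs : M * |s j| ≤ 1 := by nlinarith
    have hincr : |s (j + 1) - s j| ≤ 12 * M * s 0 ^ 2 := by
      have heq : s (j + 1) - s j =
          s j ^ 2 * (A (s j) + B (s j) + s j * A (s j) * B (s j)) := by
        rw [hs]; ring
      have hAB : |s j * A (s j) * B (s j)| ≤ M := by
        rw [abs_mul, abs_mul]
        calc |s j| * |A (s j)| * |B (s j)| ≤ |s j| * M * M := by
              gcongr
              exacts [hA _ hsr, hB _ hsr]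
          _ ≤ M := by nlinarith
      have hsum : |A (s j) + B (s j) + s j * A (s j) * B (s j)| ≤ 3 * M := by
        have := abs_add_three (A (s j)) (B (s j)) (s j * A (s j) * B (s j))
        linarith [hA _ hsr, hB _ hsr]
      have hsq : s j ^ 2 ≤ 4 * s 0 ^ 2 := by
        rw [← sq_abs (s j), ← sq_abs (s 0)]
        nlinarith [abs_nonneg (s j)]
      rw [heq, abs_mul, abs_of_nonneg (sq_nonneg (s j))]
      calc s j ^ 2 * |A (s j) + B (s j) + s j * A (s j) * B (s j)|
          ≤ 4 * s 0 ^ 2 * (3 * M) := by gcongr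
        _ = 12 * M * s 0 ^ 2 := by ring
    have hd' : |s (j + 1) - s 0| ≤ 12 * M * (j + 1) * s 0 ^ 2 := by
      have := abs_sub_le (s (j + 1)) (s j) (s 0)
      linarith
    refine ⟨by push_cast; exact hd', ?_⟩
    have hsmall : 12 * M * (j + 1) * s 0 ^ 2 ≤ |s 0| := by
      have hjs : 12 * M * ((j + 1) * |s 0|) ≤ 1 := by
        have : (j + 1) * |s 0| ≤ k * |s 0| := by gcongr
        have := mul_le_mul_of_nonneg_left this (by linarith : 0 ≤ M)
        have : 0 ≤ M * (k * |s 0|) := by positivity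
        linarith
      rw [← sq_abs (s 0)]
      calc 12 * M * (j + 1) * |s 0| ^ 2 = 12 * M * ((j + 1) * |s 0|) * |s 0| := by ring
        _ ≤ 1 * |s 0| := by gcongr
        _ = |s 0| := one_mul _
    have := abs_sub_abs_le_abs_sub (s (j + 1)) (s 0)
    linarith

/-- First order expansion of the product of the factors `1 + s j * F (s j)` when `s` stays close to
its initial value. -/
theorem abs_prod_sub_le {s : ℕ → ℝ} {F : ℝ → ℝ} {M r : ℝ} {k : ℕ} (hM : 1 ≤ M)
    (hF : ∀ t, |t| ≤ r → |F t| ≤ M) (hF' : ∀ t, |t| ≤ r → |F t - F 0| ≤ M * |t|)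
    (hr : 2 * (k * |s 0|) ≤ r) (hk : 18 * M * (k * |s 0|) ≤ 1)
    (hs : ∀ j < k, |s j - s 0| ≤ 12 * M * j * s 0 ^ 2 ∧ |s j| ≤ 2 * |s 0|) {j : ℕ} (hj : j ≤ k) :
    |∏ i ∈ Finset.range j, (1 + s i * F (s i)) - (1 + j * F 0 * s 0)|
      ≤ 18 * M ^ 2 * j ^ 2 * s 0 ^ 2 := by
  have h0 := abs_nonneg (s 0)
  induction j with
  | zero => simp
  | succ j ih =>
    specialize ih (by omega)
    obtain ⟨hd, hle⟩ := hs j (by omega)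
    have hk1 : (j : ℝ) + 1 ≤ k := by exact_mod_cast hj
    have hj0 : (0 : ℝ) ≤ j := Nat.cast_nonneg j
    have hsr : |s j| ≤ r := by nlinarith
    have hF0 : |F 0| ≤ M := hF 0 (by simpa using (abs_nonneg _).trans hsr)
    rw [Finset.prod_range_succ]
    set P := ∏ i ∈ Finset.range j, (1 + s i * F (s i))
    have hu : |s j * F (s j)| ≤ 2 * M * |s 0| := by
      rw [abs_mul]
      calc |s j| * |F (s j)| ≤ 2 * |s 0| * M := by
            gcongr
            exact hF _ hsr
        _ = 2 * M * |s 0| := by ring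
    have hu' : |s j * F (s j) - F 0 * s 0| ≤ 14 * M ^ 2 * (j + 1) * s 0 ^ 2 := by
      have heq : s j * F (s j) - F 0 * s 0 = (s j - s 0) * F (s j) + s 0 * (F (s j) - F 0) := by
        ring
      have h1 : |(s j - s 0) * F (s j)| ≤ 12 * M * j * s 0 ^ 2 * M := by
        rw [abs_mul]
        gcongr
        exact hF _ hsr
      have h2 : |s 0 * (F (s j) - F 0)| ≤ 2 * M * s 0 ^ 2 := by
        rw [abs_mul, ← sq_abs (s 0)]
        calc |s 0| * |F (s j) - F 0| ≤ |s 0| * (M * (2 * |s 0|)) := by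
              gcongr
              exact (hF' _ hsr).trans (by gcongr)
          _ = 2 * M * |s 0| ^ 2 := by ring
      have h3 : M * s 0 ^ 2 ≤ M ^ 2 * s 0 ^ 2 := by
        gcongr
        nlinarith
      have h4 : 0 ≤ M ^ 2 * j * s 0 ^ 2 := by positivity
      rw [heq]
      have := abs_add_le ((s j - s 0) * F (s j)) (s 0 * (F (s j) - F 0))
      nlinarith
    have hP : |P - 1| ≤ 2 * M * j * |s 0| := by
      have h1 : |j * F 0 * s 0| ≤ M * j * |s 0| := by
        rw [abs_mul, abs_mul, Nat.abs_cast]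
        calc j * |F 0| * |s 0| ≤ j * M * |s 0| := by gcongr
          _ = M * j * |s 0| := by ring
      have h2 : 18 * M ^ 2 * j ^ 2 * s 0 ^ 2 ≤ M * j * |s 0| := by
        have hjs : 18 * M * (j * |s 0|) ≤ 1 := by
          refine le_trans ?_ hk
          gcongr
          linarith
        rw [← sq_abs (s 0)]
        calc 18 * M ^ 2 * j ^ 2 * |s 0| ^ 2 = 18 * M * (j * |s 0|) * (M * j * |s 0|) := by ring
          _ ≤ 1 * (M * j * |s 0|) := by gcongr
          _ = M * j * |s 0| := one_mul _
      have heq : P - 1 = (P - (1 + j * F 0 * s 0)) + j * F 0 * s 0 := by ring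
      rw [heq]
      have := abs_add_le (P - (1 + j * F 0 * s 0)) (j * F 0 * s 0)
      linarith
    have hPu : |(P - 1) * (s j * F (s j))| ≤ 4 * M ^ 2 * j * s 0 ^ 2 := by
      rw [abs_mul, ← sq_abs (s 0)]
      calc |P - 1| * |s j * F (s j)| ≤ 2 * M * j * |s 0| * (2 * M * |s 0|) := by gcongr
        _ = 4 * M ^ 2 * j * |s 0| ^ 2 := by ring
    have heq : P * (1 + s j * F (s j)) - (1 + ((j + 1 : ℕ) : ℝ) * F 0 * s 0) =
        (P - (1 + j * F 0 * s 0)) + (P - 1) * (s j * F (s j)) + (s j * F (s j) - F 0 * s 0) := by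
      push_cast; ring
    rw [heq]
    have h4 : 0 ≤ M ^ 2 * j * s 0 ^ 2 := by positivity
    have h5 : 0 ≤ M ^ 2 * s 0 ^ 2 := by positivity
    have := abs_add_three (P - (1 + j * F 0 * s 0)) ((P - 1) * (s j * F (s j)))
      (s j * F (s j) - F 0 * s 0)
    push_cast
    linarith

theorem iterate_expansion_resonant_case
    (T₀ : ℝ × ℝ → ℝ × ℝ) (A B : ℝ → ℝ)
    (lam : ℝ) (N : Set (ℝ × ℝ))
    (hA : ContDiff ℝ (⊤ : ℕ∞) A) (hB : ContDiff ℝ (⊤ : ℕ∞) B)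
    (hlam0 : 0 < |lam|) (hlam1 : |lam| < 1)
    (hT₀ : ∀ p : ℝ × ℝ, T₀ p =
      (lam * p.1 * (1 + p.1 * p.2 * A (p.1 * p.2)),
       (1 / lam) * p.2 * (1 + p.1 * p.2 * B (p.1 * p.2))))
    (hNopen : IsOpen N) (hNconv : Convex ℝ N) (hNbdd : Bornology.IsBounded N)
    (hN0 : ((0 : ℝ), (0 : ℝ)) ∈ N) :
    ∃ δ > 0, ∃ C > 0, ∀ k : ℕ, 1 ≤ k → ∀ x y : ℝ,
      (k : ℝ) * |x * y| ≤ δ →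
      (∀ j < k, T₀^[j] (x, y) ∈ N) →
      |(T₀^[k] (x, y)).1 - lam ^ k * x * (1 + (k : ℝ) * A 0 * (x * y))|
        ≤ C * |lam| ^ k * |x| * (k : ℝ) ^ 2 * (x ^ 2 * y ^ 2) ∧
      |(T₀^[k] (x, y)).2 - lam ^ (-(k : ℤ)) * y * (1 + (k : ℝ) * B 0 * (x * y))|
        ≤ C * |lam| ^ (-(k : ℤ)) * |y| * (k : ℝ) ^ 2 * (x ^ 2 * y ^ 2) := by
  obtain ⟨MA, hMA⟩ := exists_local_bounds (hA.differentiable (by simp)).differentiableAt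
  obtain ⟨MB, hMB⟩ := exists_local_bounds (hB.differentiable (by simp)).differentiableAt
  obtain ⟨M, hM, hMA', hMB'⟩ : ∃ M : ℝ, 1 ≤ M ∧ MA ≤ M ∧ MB ≤ M :=
    ⟨max 1 (max MA MB), by simp, by simp, by simp⟩
  obtain ⟨r, hr, hball⟩ := Metric.nhds_basis_closedBall.eventually_iff.mp
    ((hMA M hMA').and (hMB M hMB'))
  replace hball : ∀ t : ℝ, |t| ≤ r → _ := fun t ht => hball (by simpa using ht)
  refine ⟨min (r / 2) (1 / (18 * M)), by positivity, 18 * M ^ 2, by positivity, ?_⟩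
  intro k _ x y hδ _
  have hlam : lam ≠ 0 := abs_pos.mp hlam0
  set s : ℕ → ℝ := fun j => (T₀^[j] (x, y)).1 * (T₀^[j] (x, y)).2 with hs
  have hs0 : s 0 = x * y := rfl
  have hrec : ∀ j, s (j + 1) = s j * (1 + s j * A (s j)) * (1 + s j * B (s j)) := fun j => by
    simp only [hs, Function.iterate_succ_apply', hT₀]
    field_simp
  have hr' : 2 * (k * |s 0|) ≤ r := by
    rw [hs0]
    linarith [hδ.trans (min_le_left _ _)]
  have hk : 18 * M * (k * |s 0|) ≤ 1 := by
    have := hδ.trans (min_le_right _ _)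
    rwa [le_div_iff₀' (by positivity), ← hs0] at this
  have hclose : ∀ j < k, _ := fun j hj => abs_sub_le_of_quadratic_recursion hM
    (fun t ht => (hball t ht).1.1) (fun t ht => (hball t ht).2.1) hrec hr' hk hj
  have hX : ∀ j, (T₀^[j] (x, y)).1 =
      lam ^ j * x * ∏ i ∈ Finset.range j, (1 + s i * A (s i)) := fun j => by
    induction j with
    | zero => simp
    | succ j ih =>
      rw [Finset.prod_range_succ, Function.iterate_succ_apply', hT₀]
      change lam * (T₀^[j] (x, y)).1 * (1 + s j * A (s j)) = _
      rw [ih]; ring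
  have hY : ∀ j : ℕ, (T₀^[j] (x, y)).2 =
      lam ^ (-(j : ℤ)) * y * ∏ i ∈ Finset.range j, (1 + s i * B (s i)) := fun j => by
    induction j with
    | zero => simp
    | succ j ih =>
      rw [Finset.prod_range_succ, Function.iterate_succ_apply', hT₀]
      change 1 / lam * (T₀^[j] (x, y)).2 * (1 + s j * B (s j)) = _
      rw [ih]
      simp only [zpow_neg, zpow_natCast, pow_succ, mul_inv]
      ring
  have hPX := abs_prod_sub_le hM (fun t ht => (hball t ht).1.1) (fun t ht => (hball t ht).1.2)
    hr' hk hclose le_rfl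
  have hPY := abs_prod_sub_le hM (fun t ht => (hball t ht).2.1) (fun t ht => (hball t ht).2.2)
    hr' hk hclose le_rfl
  rw [hs0, mul_pow] at hPX hPY
  constructor
  · rw [hX, ← mul_sub, abs_mul, abs_mul, abs_pow]
    calc _ ≤ |lam| ^ k * |x| * (18 * M ^ 2 * k ^ 2 * (x ^ 2 * y ^ 2)) := by gcongr
      _ = _ := by ring
  · rw [hY, ← mul_sub, abs_mul, abs_mul, abs_zpow]
    calc _ ≤ |lam| ^ (-(k : ℤ)) * |y| * (18 * M ^ 2 * k ^ 2 * (x ^ 2 * y ^ 2)) := by gcongr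
      _ = _ := by ring
end
end

section
/- Let f be the explicit piecewise map defined in the context with parameters λ = 4/5, σ = 5/4, c₂ = −1/2, d₁ = 1, d₅ = 1. Then there exists an integer k_min such that for every integer k ≥ k_min: (i) there is a point p ∈ ℝ² with f^{k+1}(p) = p whose periodic orbit is asymptotically stable, and (ii) there is a point q ∈ ℝ² with f^{k+1}(q) = q such that the Jacobian matrix of f^{k+1} at q has real eigenvalues μ₁, μ₂ with |μ₁| < 1 < |μ₂|. -/
open Filter Metric

noncomputable section

/-- Jacobian matrix of a planar map at a point. -/
def jac (T : ℝ × ℝ → ℝ × ℝ) (z : ℝ × ℝ) : Matrix (Fin 2) (Fin 2) ℝ :=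
  !![fderiv ℝ (fun p => (T p).1) z (1, 0), fderiv ℝ (fun p => (T p).1) z (0, 1);
     fderiv ℝ (fun p => (T p).2) z (1, 0), fderiv ℝ (fun p => (T p).2) z (0, 1)]

/-- The forward orbit of a point under a planar map. -/
def orbit (f : ℝ × ℝ → ℝ × ℝ) (p : ℝ × ℝ) : Set (ℝ × ℝ) :=
  Set.range fun n : ℕ => f^[n] p

/-- A periodic orbit (through `p`) is Lyapunov stable if every forward orbit starting
close enough to the orbit stays close to it. -/
def LyapStable (f : ℝ × ℝ → ℝ × ℝ) (p : ℝ × ℝ) : Prop :=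
  ∀ ε > 0, ∃ δ > 0, ∀ q : ℝ × ℝ, infDist q (orbit f p) < δ →
    ∀ n : ℕ, infDist (f^[n] q) (orbit f p) < ε

/-- Asymptotic stability: Lyapunov stability together with local attractivity. -/
def AsympStable (f : ℝ × ℝ → ℝ × ℝ) (p : ℝ × ℝ) : Prop :=
  LyapStable f p ∧ ∃ δ > 0, ∀ q : ℝ × ℝ, infDist q (orbit f p) < δ →
    Tendsto (fun n : ℕ => infDist (f^[n] q) (orbit f p)) atTop (nhds 0)

/-- `h₀ = (2|λ|+1)/3`. -/
def h0 (lam : ℝ) : ℝ := (2 * |lam| + 1) / 3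

/-- `h₁ = (|λ|+2)/3`. -/
def h1 (lam : ℝ) : ℝ := (|lam| + 2) / 3

/-- `U₀(x,y) = (λx, σy)`. -/
def Umap0 (lam sig : ℝ) (p : ℝ × ℝ) : ℝ × ℝ := (lam * p.1, sig * p.2)

/-- `U₁(x,y) = (1 + c₂(y−1), d₁x + d₅(y−1)²)`. -/
def Umap1 (c₂ d₁ d₅ : ℝ) (p : ℝ × ℝ) : ℝ × ℝ :=
  (1 + c₂ * (p.2 - 1), d₁ * p.1 + d₅ * (p.2 - 1) ^ 2)

/-- `s(z) = 3z² − 2z³`. -/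
def sfun (z : ℝ) : ℝ := 3 * z ^ 2 - 2 * z ^ 3

/-- `r(y) = s((y−h₀)/(h₁−h₀))`. -/
def rfun (lam : ℝ) (y : ℝ) : ℝ := sfun ((y - h0 lam) / (h1 lam - h0 lam))

/-- The explicit piecewise map of the example. -/
def fmap (lam sig c₂ d₁ d₅ : ℝ) (p : ℝ × ℝ) : ℝ × ℝ :=
  if p.2 ≤ h0 lam then Umap0 lam sig p
  else if h1 lam ≤ p.2 then Umap1 c₂ d₁ d₅ p
  else (1 - rfun lam p.2) • Umap0 lam sig p + rfun lam p.2 • Umap1 c₂ d₁ d₅ p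

/-- The orbit of a periodic point is finite. -/
theorem finite_orbit {f : ℝ × ℝ → ℝ × ℝ} {p : ℝ × ℝ} {n : ℕ} (hn : 0 < n)
    (hp : f^[n] p = p) : (orbit f p).Finite := by
  refine ((Set.finite_Iio n).image fun i => f^[i] p).subset ?_
  rintro _ ⟨m, rfl⟩
  exact ⟨m % n, Nat.mod_lt _ hn, Function.IsPeriodicPt.iterate_mod_apply hp m⟩

/-- Every point of a periodic orbit returns to the base point. -/
theorem exists_iterate_eq_of_mem_orbit {f : ℝ × ℝ → ℝ × ℝ} {p o : ℝ × ℝ} {n : ℕ} (hn : 0 < n)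
    (hp : f^[n] p = p) (ho : o ∈ orbit f p) : ∃ j, f^[j] o = p := by
  obtain ⟨m, rfl⟩ := ho
  refine ⟨n * m - m, ?_⟩
  have hp' : Function.IsPeriodicPt f n p := hp
  change f^[n * m - m] (f^[m] p) = p
  rw [← Function.iterate_add_apply, Nat.sub_add_cancel (Nat.le_mul_of_pos_left m hn)]
  exact hp'.mul_const m

theorem iterate_mem_orbit {f : ℝ × ℝ → ℝ × ℝ} {p o : ℝ × ℝ} (ho : o ∈ orbit f p) (i : ℕ) :
    f^[i] o ∈ orbit f p := by
  obtain ⟨m, rfl⟩ := ho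
  exact ⟨i + m, Function.iterate_add_apply f i m p⟩

theorem eventually_infDist_iterate_lt {f : ℝ × ℝ → ℝ × ℝ} (hf : Continuous f) {p o : ℝ × ℝ}
    (ho : o ∈ orbit f p) (n : ℕ) {ε : ℝ} (hε : 0 < ε) :
    ∀ᶠ z in nhds o, ∀ i < n, infDist (f^[i] z) (orbit f p) < ε := by
  refine (Filter.eventually_all_finite (Set.finite_Iio n)).2 fun i _ => ?_
  have hc : Continuous fun z => infDist (f^[i] z) (orbit f p) :=
    (continuous_infDist_pt _).comp (hf.iterate i)
  refine hc.continuousAt.eventually_lt_const ?_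
  simpa only [infDist_zero_of_mem (iterate_mem_orbit ho i)] using hε

/-- A set that is a neighbourhood of every point of a periodic orbit contains a metric
neighbourhood of the orbit. -/
theorem exists_infDist_lt_imp_mem {f : ℝ × ℝ → ℝ × ℝ} {p : ℝ × ℝ} {n : ℕ} (hn : 0 < n)
    (hp : f^[n] p = p) {W : Set (ℝ × ℝ)} (hW : ∀ o ∈ orbit f p, W ∈ nhds o) :
    ∃ δ > 0, ∀ q, infDist q (orbit f p) < δ → q ∈ W := by
  have hK : IsCompact (orbit f p) := (finite_orbit hn hp).isCompact
  have hne : (orbit f p).Nonempty := ⟨_, 0, rfl⟩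
  obtain ⟨δ, hδ, h⟩ := (hasBasis_nhdsSet_thickening hK).mem_iff.1 (mem_nhdsSet_iff_forall.2 hW)
  exact ⟨δ, hδ, fun q hq => h ((mem_thickening_iff_infDist_lt hne).2 hq)⟩

/-- A periodic orbit is asymptotically stable as soon as one of its points is an asymptotically
stable fixed point of the return map. -/
theorem asympStable_of_iterate {f : ℝ × ℝ → ℝ × ℝ} (hf : Continuous f) {p : ℝ × ℝ} {n : ℕ}
    (hn : 0 < n) (hp : f^[n] p = p)
    (hstab : ∀ U ∈ nhds p, ∀ᶠ z in nhds p, ∀ m, (f^[n])^[m] z ∈ U)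
    (hattr : ∀ᶠ z in nhds p, Tendsto (fun m => (f^[n])^[m] z) atTop (nhds p)) :
    AsympStable f p := by
  have hpo : p ∈ orbit f p := ⟨0, rfl⟩
  have hsplit : ∀ N z, f^[N] z = f^[N % n] ((f^[n])^[N / n] z) := fun N z => by
    rw [← Function.iterate_mul, ← Function.iterate_add_apply, Nat.mod_add_div]
  constructor
  · intro ε hε
    refine exists_infDist_lt_imp_mem hn hp (W := {z | ∀ N, infDist (f^[N] z) (orbit f p) < ε}) ?_
    intro o ho
    obtain ⟨j, hj⟩ := exists_iterate_eq_of_mem_orbit hn hp ho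
    have hbase : ∀ᶠ z in nhds p, ∀ N, infDist (f^[N] z) (orbit f p) < ε := by
      filter_upwards [hstab _ (eventually_infDist_iterate_lt hf hpo n hε)] with z hz N
      rw [hsplit]
      exact hz _ _ (Nat.mod_lt _ hn)
    have hcj : Tendsto f^[j] (nhds o) (nhds p) := by
      simpa only [hj] using (hf.iterate j).tendsto o
    filter_upwards [hcj.eventually hbase, eventually_infDist_iterate_lt hf ho j hε]
      with z hz hz' N
    rcases lt_or_ge N j with h | h
    · exact hz' N h
    · have := hz (N - j)
      rwa [← Function.iterate_add_apply, Nat.sub_add_cancel h] at this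
  · refine exists_infDist_lt_imp_mem hn hp
      (W := {z | Tendsto (fun N => infDist (f^[N] z) (orbit f p)) atTop (nhds 0)}) ?_
    intro o ho
    obtain ⟨j, hj⟩ := exists_iterate_eq_of_mem_orbit hn hp ho
    have hcj : Tendsto f^[j] (nhds o) (nhds p) := by
      simpa only [hj] using (hf.iterate j).tendsto o
    filter_upwards [hcj.eventually hattr] with z hz
    refine (tendsto_add_atTop_iff_nat j).1 ?_
    simp only [Function.iterate_add_apply]
    refine tendsto_order.2 ⟨fun a ha => .of_forall fun _ => ha.trans_le infDist_nonneg,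
      fun ε hε => ?_⟩
    have hdiv : Tendsto (fun N => N / n) atTop atTop := Nat.tendsto_div_const_atTop hn.ne'
    filter_upwards [(hz.comp hdiv).eventually (eventually_infDist_iterate_lt hf hpo n hε)]
      with N hN
    rw [hsplit]
    exact hN _ (Nat.mod_lt _ hn)

/-- A strict Lyapunov function with geometric decay bounds all iterates. -/
theorem iterate_le_of_contracting {X : Type*} {g : X → X} {V : X → ℝ} {c ρ : ℝ} (hc₀ : 0 ≤ c)
    (hc₁ : c ≤ 1) (hV₀ : ∀ z, 0 ≤ V z) (hV : ∀ z, V z < ρ → V (g z) ≤ c * V z) {z : X}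
    (hz : V z < ρ) (m : ℕ) : V (g^[m] z) ≤ c ^ m * V z := by
  induction m with
  | zero => simp
  | succ m ih =>
    have hlt : V (g^[m] z) < ρ :=
      (ih.trans (mul_le_of_le_one_left (hV₀ z) (pow_le_one₀ hc₀ hc₁))).trans_lt hz
    rw [Function.iterate_succ_apply', pow_succ', mul_assoc]
    exact (hV _ hlt).trans (mul_le_mul_of_nonneg_left ih hc₀)

/-- Asymptotic stability of a periodic orbit from a Lyapunov function for the return map. -/
theorem asympStable_of_lyapunov {f : ℝ × ℝ → ℝ × ℝ} (hf : Continuous f) {p : ℝ × ℝ} {n : ℕ}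
    (hn : 0 < n) (hp : f^[n] p = p) {V : ℝ × ℝ → ℝ} (hVc : Continuous V) (hVp : V p = 0)
    (hVd : ∀ z, dist z p ≤ V z) {c ρ : ℝ} (hc₀ : 0 ≤ c) (hc₁ : c < 1) (hρ : 0 < ρ)
    (hV : ∀ z, V z < ρ → V (f^[n] z) ≤ c * V z) : AsympStable f p := by
  have hV₀ : ∀ z, 0 ≤ V z := fun z => dist_nonneg.trans (hVd z)
  have hsmall : ∀ ε > 0, ∀ᶠ z in nhds p, V z < ε := fun ε hε =>
    hVc.continuousAt.eventually_lt_const (hVp.trans_lt hε)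
  refine asympStable_of_iterate hf hn hp (fun U hU => ?_) ?_
  · obtain ⟨ε, hε, hU⟩ := Metric.mem_nhds_iff.1 hU
    filter_upwards [hsmall ρ hρ, hsmall ε hε] with z hzρ hzε m
    refine hU (((hVd _).trans (iterate_le_of_contracting hc₀ hc₁.le hV₀ hV hzρ m)).trans_lt ?_)
    exact (mul_le_of_le_one_left (hV₀ z) (pow_le_one₀ hc₀ hc₁.le)).trans_lt hzε
  · filter_upwards [hsmall ρ hρ] with z hz
    refine tendsto_iff_dist_tendsto_zero.2 (squeeze_zero (fun _ => dist_nonneg)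
      (fun m => (hVd _).trans (iterate_le_of_contracting hc₀ hc₁.le hV₀ hV hz m)) ?_)
    simpa using (tendsto_pow_atTop_nhds_zero_of_lt_one hc₀ hc₁).mul_const (V z)

theorem h0_four_fifths : h0 (4 / 5) = 13 / 15 := by
  norm_num [h0, abs_of_pos]

theorem h1_four_fifths : h1 (4 / 5) = 14 / 15 := by
  norm_num [h1, abs_of_pos]

theorem continuous_fmap (sig c₂ d₁ d₅ : ℝ) : Continuous (fmap (4 / 5) sig c₂ d₁ d₅) := by
  have hU₀ : Continuous (Umap0 (4 / 5) sig) := by unfold Umap0; fun_prop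
  have hU₁ : Continuous (Umap1 c₂ d₁ d₅) := by unfold Umap1; fun_prop
  have hr : Continuous fun p : ℝ × ℝ => rfun (4 / 5) p.2 := by
    unfold rfun sfun; fun_prop
  refine Continuous.if_le hU₀ (Continuous.if_le hU₁ (by fun_prop) continuous_const
    continuous_snd ?_) continuous_snd continuous_const ?_
  · intro p hp
    have : rfun (4 / 5) p.2 = 1 := by
      rw [← hp, rfun, div_self, sfun]
      · norm_num
      · norm_num [h0_four_fifths, h1_four_fifths]
    simp [this]
  · intro p hp
    have : rfun (4 / 5) p.2 = 0 := by simp [hp, rfun, sfun]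
    have h : ¬ h1 (4 / 5) ≤ p.2 := by rw [hp, h0_four_fifths, h1_four_fifths]; norm_num
    simp [this, h]

theorem fmap_of_le {sig c₂ d₁ d₅ : ℝ} {p : ℝ × ℝ} (h : p.2 ≤ 13 / 15) :
    fmap (4 / 5) sig c₂ d₁ d₅ p = Umap0 (4 / 5) sig p :=
  if_pos (h.trans_eq h0_four_fifths.symm)

theorem fmap_of_ge {sig c₂ d₁ d₅ : ℝ} {p : ℝ × ℝ} (h : 14 / 15 ≤ p.2) :
    fmap (4 / 5) sig c₂ d₁ d₅ p = Umap1 c₂ d₁ d₅ p := by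
  rw [fmap, if_neg (by rw [h0_four_fifths]; linarith), if_pos (by rwa [h1_four_fifths])]

theorem fmap_iterate_of_le {c₂ d₁ d₅ : ℝ} {k : ℕ} {p : ℝ × ℝ}
    (h : (5 / 4) ^ k * p.2 ≤ 13 / 12) :
    (fmap (4 / 5) (5 / 4) c₂ d₁ d₅)^[k] p = ((4 / 5) ^ k * p.1, (5 / 4) ^ k * p.2) := by
  induction k with
  | zero => simp
  | succ k ih =>
    have hk : (5 / 4) ^ k * p.2 ≤ 13 / 15 := by rw [pow_succ] at h; linarith
    rw [Function.iterate_succ_apply', ih (hk.trans (by norm_num)), fmap_of_le hk, Umap0,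
      pow_succ', pow_succ', mul_assoc, mul_assoc]

/-- The composition of `k` steps of `U₀` with one step of `U₁`. -/
def returnMap (k : ℕ) (p : ℝ × ℝ) : ℝ × ℝ :=
  (1 + -1 / 2 * ((5 / 4) ^ k * p.2 - 1), (4 / 5) ^ k * p.1 + ((5 / 4) ^ k * p.2 - 1) ^ 2)

theorem fmap_iterate_succ {k : ℕ} {p : ℝ × ℝ} (hl : 14 / 15 ≤ (5 / 4) ^ k * p.2)
    (hu : (5 / 4) ^ k * p.2 ≤ 13 / 12) :
    (fmap (4 / 5) (5 / 4) (-1 / 2) 1 1)^[k + 1] p = returnMap k p := by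
  rw [Function.iterate_succ_apply', fmap_iterate_of_le hu, fmap_of_ge hl]
  simp [Umap1, returnMap]

theorem jac_congr {T G : ℝ × ℝ → ℝ × ℝ} {z : ℝ × ℝ} (h : T =ᶠ[nhds z] G) : jac T z = jac G z := by
  have h₁ : (fun p => (T p).1) =ᶠ[nhds z] fun p => (G p).1 := h.fun_comp Prod.fst
  have h₂ : (fun p => (T p).2) =ᶠ[nhds z] fun p => (G p).2 := h.fun_comp Prod.snd
  rw [jac, jac, h₁.fderiv_eq, h₂.fderiv_eq]

theorem jac_returnMap (k : ℕ) (z : ℝ × ℝ) :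
    jac (returnMap k) z = !![0, -1 / 2 * (5 / 4) ^ k;
      (4 / 5) ^ k, 2 * ((5 / 4) ^ k * z.2 - 1) * (5 / 4) ^ k] := by
  have hw : HasFDerivAt (fun p : ℝ × ℝ => (5 / 4 : ℝ) ^ k * p.2 - 1)
      ((5 / 4 : ℝ) ^ k • ContinuousLinearMap.snd ℝ ℝ ℝ) z :=
    (hasFDerivAt_snd.const_mul _).sub_const _
  have h₁ := (hw.const_mul (-1 / 2)).const_add 1
  have h₂ := ((hasFDerivAt_fst (𝕜 := ℝ) (p := z)).const_mul ((4 / 5 : ℝ) ^ k)).add (hw.pow 2)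
  have e₁ : fderiv ℝ (fun p => (returnMap k p).1) z = _ := h₁.fderiv
  have e₂ : fderiv ℝ (fun p => (returnMap k p).2) z = _ := h₂.fderiv
  rw [jac, e₁, e₂]
  ext i j
  fin_cases i <;> fin_cases j <;> simp

theorem exists_asympStable_periodic (k : ℕ) :
    ∃ p : ℝ × ℝ, (fmap (4 / 5) (5 / 4) (-1 / 2) 1 1)^[k + 1] p = p ∧
      AsympStable (fmap (4 / 5) (5 / 4) (-1 / 2) 1 1) p := by
  have hSL : (5 / 4 : ℝ) ^ k * (4 / 5) ^ k = 1 := by rw [← mul_pow]; norm_num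
  have hS : 1 ≤ (5 / 4 : ℝ) ^ k := one_le_pow₀ (by norm_num)
  have hL₀ : 0 < (4 / 5 : ℝ) ^ k := by positivity
  have hL : (4 / 5 : ℝ) ^ k ≤ 1 := pow_le_one₀ (by norm_num) (by norm_num)
  have hp : (fmap (4 / 5) (5 / 4) (-1 / 2) 1 1)^[k + 1] (1, (4 / 5) ^ k) = (1, (4 / 5) ^ k) := by
    rw [fmap_iterate_succ] <;> norm_num [returnMap, hSL]
  refine ⟨_, hp, asympStable_of_lyapunov (continuous_fmap _ _ _ _) k.succ_pos hp
    (V := fun z => max (3 / 2 * |z.1 - 1|) |(5 / 4) ^ k * z.2 - 1|) (by fun_prop)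
    (by simp [hSL]) ?_ (c := 3 / 4) (ρ := (4 / 5) ^ k / 20) (by norm_num) (by norm_num)
    (by positivity) ?_⟩
  · intro z
    rw [Prod.dist_eq, Real.dist_eq, Real.dist_eq]
    refine max_le_max (by linarith [abs_nonneg (z.1 - 1)]) ?_
    have : (5 / 4) ^ k * z.2 - 1 = (5 / 4) ^ k * (z.2 - (4 / 5) ^ k) := by
      rw [mul_sub, hSL]
    dsimp only
    rw [this, abs_mul, abs_of_pos (zero_lt_one.trans_le hS)]
    exact le_mul_of_one_le_left (abs_nonneg _) hS
  · intro z hz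
    set S : ℝ := (5 / 4) ^ k
    set L : ℝ := (4 / 5) ^ k
    set w := S * z.2 - 1 with hw
    set u := z.1 - 1 with hu
    set v := max (3 / 2 * |u|) |w| with hv
    have h₁ : 3 / 2 * |u| ≤ v := le_max_left _ _
    have h₂ : |w| ≤ v := le_max_right _ _
    have hw' := abs_le.1 (h₂.trans hz.le)
    rw [fmap_iterate_succ (by linarith) (by linarith)]
    have e₁ : (returnMap k z).1 - 1 = -1 / 2 * w := by simp [returnMap, hw, S]
    have e₂ : S * (returnMap k z).2 - 1 = u + S * w * w := by
      change S * (L * z.1 + w ^ 2) - 1 = u + S * w * w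
      linear_combination z.1 * hSL
    rw [e₁, e₂]
    have hSw : |S * w| ≤ 1 / 20 := by
      rw [abs_mul, abs_of_pos (by linarith)]
      calc S * |w| ≤ S * (L / 20) := by gcongr; exact h₂.trans hz.le
        _ = 1 / 20 := by linear_combination hSL / 20
    refine max_le ?_ ((abs_add_le _ _).trans ?_)
    · rw [abs_mul]; norm_num; linarith
    · rw [abs_mul]
      have : |S * w| * |w| ≤ 1 / 20 * v := mul_le_mul hSw h₂ (abs_nonneg _) (by norm_num)
      linarith [abs_nonneg w]

theorem exists_saddle_periodic {k : ℕ} (hk : (4 / 5 : ℝ) ^ k ≤ 1 / 20) :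
    ∃ q : ℝ × ℝ, (fmap (4 / 5) (5 / 4) (-1 / 2) 1 1)^[k + 1] q = q ∧
      ∃ μ₁ μ₂ : ℝ,
        μ₁ + μ₂ = Matrix.trace (jac ((fmap (4 / 5) (5 / 4) (-1 / 2) 1 1)^[k + 1]) q) ∧
        μ₁ * μ₂ = (jac ((fmap (4 / 5) (5 / 4) (-1 / 2) 1 1)^[k + 1]) q).det ∧
        |μ₁| < 1 ∧ 1 < |μ₂| := by
  have hSL : (5 / 4 : ℝ) ^ k * (4 / 5) ^ k = 1 := by rw [← mul_pow]; norm_num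
  have hL₀ : 0 < (4 / 5 : ℝ) ^ k := by positivity
  set L : ℝ := (4 / 5) ^ k with hL
  set q : ℝ × ℝ := (1 - 3 / 4 * L, L * (1 + 3 / 2 * L)) with hq
  have hq₂ : (5 / 4) ^ k * q.2 = 1 + 3 / 2 * L := by
    simp only [hq]
    linear_combination (1 + 3 / 2 * L) * hSL
  have hlow : 14 / 15 < (5 / 4) ^ k * q.2 := by rw [hq₂]; linarith
  have hupp : (5 / 4) ^ k * q.2 < 13 / 12 := by rw [hq₂]; linarith
  have hev : (fmap (4 / 5) (5 / 4) (-1 / 2) 1 1)^[k + 1] =ᶠ[nhds q] returnMap k := by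
    have hc : ContinuousAt (fun z : ℝ × ℝ => (5 / 4 : ℝ) ^ k * z.2) q := by fun_prop
    filter_upwards [hc.eventually_const_lt hlow, hc.eventually_lt_const hupp] with z h₁ h₂
    exact fmap_iterate_succ h₁.le h₂.le
  refine ⟨q, ?_, (3 - √7) / 2, (3 + √7) / 2, ?_⟩
  · rw [hev.eq_of_nhds, returnMap, hq₂, ← hL]
    ext <;> simp only [hq] <;> ring
  · have h7 : √7 ^ 2 = 7 := Real.sq_sqrt (by norm_num)
    have h7₀ : 0 ≤ √7 := Real.sqrt_nonneg 7
    rw [jac_congr hev, jac_returnMap, hq₂, Matrix.trace_fin_two_of, Matrix.det_fin_two_of, ← hL]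
    refine ⟨by linear_combination -3 * hSL, by linear_combination -h7 / 4 - hSL / 2, ?_, ?_⟩
    · rw [abs_lt]; constructor <;> nlinarith
    · rw [abs_of_pos (by positivity)]; nlinarith

theorem example_orientation_preserving_coexistence :
    ∃ kmin : ℕ, ∀ k : ℕ, kmin ≤ k →
      (∃ p : ℝ × ℝ, (fmap (4/5) (5/4) (-1/2) 1 1)^[k + 1] p = p ∧
        AsympStable (fmap (4/5) (5/4) (-1/2) 1 1) p) ∧
      (∃ q : ℝ × ℝ, (fmap (4/5) (5/4) (-1/2) 1 1)^[k + 1] q = q ∧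
        ∃ μ₁ μ₂ : ℝ,
          μ₁ + μ₂ = Matrix.trace (jac ((fmap (4/5) (5/4) (-1/2) 1 1)^[k + 1]) q) ∧
          μ₁ * μ₂ = (jac ((fmap (4/5) (5/4) (-1/2) 1 1)^[k + 1]) q).det ∧
          |μ₁| < 1 ∧ 1 < |μ₂|) := by
  refine ⟨20, fun k hk => ⟨exists_asympStable_periodic k, exists_saddle_periodic ?_⟩⟩
  exact (pow_le_pow_of_le_one (by norm_num) (by norm_num) hk).trans (by norm_num)
end
end
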